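/- (Ramanujan's formula for Catalan's constant) G := ∑_{n=0}^∞ (−1)^n/(2n+1)² = 5π²/48 − 2 ∑_{n=0}^∞ (−1)^n (2n+1)^{−2}/(e^{(2n+1)π} − 1) − (1/4) ∑_{n=1}^∞ 1/(n² cosh(πn)). -/

import Mathlib

/-- The Basel series, indexed from zero. -/
lemma hasSum_one_div_succ_sq :
    HasSum (fun n : ℕ ↦ 1 / ((n : ℝ) + 1) ^ 2) (Real.pi ^ 2 / 6) := by
  simpa using (hasSum_nat_add_iff' 1).2 hasSum_zeta_two

open Complex in
/-- The partial fraction expansion of `π coth (π y)`, with `coth` written through `exp`. -/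
lemma hasSum_one_div_sq_add_sq {y : ℝ} (hy : 0 < y) :
    HasSum (fun k : ℕ ↦ 1 / (y ^ 2 + ((k : ℝ) + 1) ^ 2))
      ((Real.pi * (1 + 2 / (Real.exp (2 * Real.pi * y) - 1)) - 1 / y) / (2 * y)) := by
  have hz : (y : ℂ) * I ∈ integerComplement := by
    rintro ⟨n, hn⟩
    have := congrArg Complex.im hn
    simp at this
    exact hy.ne this
  have hy' : (y : ℂ) ≠ 0 := by exact_mod_cast hy.ne'
  have h := (summable_cotTerm hz).hasSum
  have h2 := cot_series_rep' hz
  simp only [cotTerm] at h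
  rw [← h2, Complex.cot_pi_eq_exp_ratio] at h
  have he : Complex.exp (2 * Real.pi * I * (y * I)) = ((Real.exp (2 * Real.pi * y))⁻¹ : ℝ) := by
    rw [← Real.exp_neg]
    push_cast
    congr 1
    linear_combination (2 * Real.pi * y : ℂ) * I_sq
  have hlt : 1 < Real.exp (2 * Real.pi * y) := Real.one_lt_exp_iff.2 (by positivity)
  rw [he] at h
  generalize Real.exp (2 * Real.pi * y) = E at hlt h
  have hE1 : (E : ℂ) - 1 ≠ 0 := by exact_mod_cast (sub_pos.2 hlt).ne'
  have hE : (E : ℂ) ≠ 0 := by exact_mod_cast (zero_lt_one.trans hlt).ne'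
  have h3 := h.mul_left (I / (2 * y))
  rw [← Complex.hasSum_ofReal]
  convert! h3 using 1
  · ext k
    have hpos : (y : ℂ) ^ 2 + (k + 1) ^ 2 ≠ 0 := by
      have : y ^ 2 + ((k : ℝ) + 1) ^ 2 ≠ 0 := by positivity
      exact_mod_cast this
    have e : ((y : ℂ) * I - (k + 1)) * (y * I + (k + 1)) = -((y : ℂ) ^ 2 + (k + 1) ^ 2) := by
      linear_combination (y : ℂ) ^ 2 * I_sq
    have hne := mul_ne_zero_iff.1 (e ▸ neg_ne_zero.2 hpos)
    rw [div_add_div _ _ hne.1 hne.2, e]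
    push_cast
    field_simp
    linear_combination (y : ℂ) * 2 * I_sq
  · push_cast
    rw [show (1 : ℂ) - (E : ℂ)⁻¹ = (E - 1) / E by field_simp]
    field_simp
    ring

open Complex in
lemma cot_pi_mul_add_cot_pi_mul (x : ℝ) :
    cot (Real.pi * (1 / 4 + x / 2 * I)) + cot (Real.pi * (1 / 4 - x / 2 * I)) =
      2 / Real.cosh (Real.pi * x) := by
  set A : ℂ := Real.pi * (1 / 4 + x / 2 * I) with hA
  set B : ℂ := Real.pi * (1 / 4 - x / 2 * I) with hB
  have h1 : sin (A + B) = 1 := by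
    rw [show A + B = Real.pi / 2 by rw [hA, hB]; ring, sin_pi_div_two]
  have h2 : cos (A + B) = 0 := by
    rw [show A + B = Real.pi / 2 by rw [hA, hB]; ring, cos_pi_div_two]
  have h3 : cos (A - B) = Real.cosh (Real.pi * x) := by
    rw [show A - B = (Real.pi * x : ℝ) * I by rw [hA, hB]; push_cast; ring, cos_mul_I, ofReal_cosh]
  have hc : (Real.cosh (Real.pi * x) : ℂ) ≠ 0 := by exact_mod_cast (Real.cosh_pos _).ne'
  rw [← h3] at hc ⊢
  have h4 : cos (A - B) = 2 * (sin A * sin B) := by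
    rw [cos_add] at h2
    rw [cos_sub]
    linear_combination h2
  rw [h4] at hc ⊢
  rw [sin_add] at h1
  have hs := mul_ne_zero_iff.1 (right_ne_zero_of_mul hc)
  have hs1 := hs.1
  have hs2 := hs.2
  rw [cot, cot]
  field_simp
  linear_combination h1

open Complex in
lemma quarter_add_mul_I_mem_integerComplement (t : ℝ) :
    (1 / 4 + t * I : ℂ) ∈ integerComplement := by
  rintro ⟨n, hn⟩
  have := congrArg Complex.re hn
  simp at this
  have h4 : (n : ℝ) * 4 = 1 := by rw [this]; norm_num
  have : n * 4 = 1 := by exact_mod_cast h4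
  omega

open Complex in
/-- The partial fraction expansion of `π / (4 cosh (π x))`, with consecutive terms paired. -/
lemma hasSum_sech_paired (x : ℝ) :
    HasSum (fun n : ℕ ↦ (4 * (n : ℝ) + 5) / ((4 * (n : ℝ) + 5) ^ 2 + 4 * x ^ 2)
        - (4 * (n : ℝ) + 3) / ((4 * (n : ℝ) + 3) ^ 2 + 4 * x ^ 2))
      (Real.pi / 4 / Real.cosh (Real.pi * x) - 1 / (1 + 4 * x ^ 2)) := by
  have key (a t : ℝ) (ha : a ≠ 0) :
      1 / ((a : ℂ) + t * I) + 1 / ((a : ℂ) - t * I) = 2 * a / (a ^ 2 + t ^ 2) := by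
    have hpos : (a : ℂ) ^ 2 + t ^ 2 ≠ 0 := by
      have : a ^ 2 + t ^ 2 ≠ 0 := by positivity
      exact_mod_cast this
    have e : ((a : ℂ) + t * I) * (a - t * I) = a ^ 2 + t ^ 2 := by
      linear_combination -(t : ℂ) ^ 2 * I_sq
    have hne := mul_ne_zero_iff.1 (e ▸ hpos)
    rw [div_add_div _ _ hne.1 hne.2, e]
    ring
  have hz : (1 / 4 + x / 2 * I : ℂ) ∈ integerComplement := by
    simpa using quarter_add_mul_I_mem_integerComplement (x / 2)
  have hw : (1 / 4 - x / 2 * I : ℂ) ∈ integerComplement := by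
    simpa [neg_div, sub_eq_add_neg] using quarter_add_mul_I_mem_integerComplement (-x / 2)
  have h := ((summable_cotTerm hz).hasSum.add (summable_cotTerm hw).hasSum).mul_left (1 / 8)
  have hz' := cot_series_rep' hz
  have hw' := cot_series_rep' hw
  simp only [cotTerm] at h
  rw [← hz', ← hw'] at h
  have scale (b : ℝ) (hb : b ≠ 0) :
      (1 / 8 : ℂ) * (2 * ((b / 4 : ℝ) : ℂ) / (((b / 4 : ℝ) : ℂ) ^ 2 + ((x / 2 : ℝ) : ℂ) ^ 2)) =
        ((b / (b ^ 2 + 4 * x ^ 2) : ℝ) : ℂ) := by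
    have hpos : b ^ 2 + 4 * x ^ 2 ≠ 0 := by positivity
    rw [← ofReal_pow, ← ofReal_pow, ← ofReal_add,
      show (b / 4) ^ 2 + (x / 2) ^ 2 = (b ^ 2 + 4 * x ^ 2) / 16 by ring]
    have hpos' : (b : ℂ) ^ 2 + 4 * x ^ 2 ≠ 0 := by exact_mod_cast hpos
    push_cast
    field_simp
    ring
  rw [← Complex.hasSum_ofReal]
  convert! h using 1
  · ext n
    have h5 : 4 * (n : ℝ) + 5 ≠ 0 := by positivity
    have h3 : 4 * (n : ℝ) + 3 ≠ 0 := by positivity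
    rw [ofReal_sub, ← scale _ h5, ← scale _ h3, ← key _ _ (by positivity),
      ← key _ _ (by positivity)]
    rw [show (1 / 4 + x / 2 * I - (n + 1) : ℂ)
        = -(((4 * (n : ℝ) + 3) / 4 : ℝ) - ((x / 2 : ℝ) : ℂ) * I) by push_cast; ring,
      show (1 / 4 - x / 2 * I - (n + 1) : ℂ)
        = -(((4 * (n : ℝ) + 3) / 4 : ℝ) + ((x / 2 : ℝ) : ℂ) * I) by push_cast; ring,
      show (1 / 4 + x / 2 * I + (n + 1) : ℂ)
        = ((4 * (n : ℝ) + 5) / 4 : ℝ) + ((x / 2 : ℝ) : ℂ) * I by push_cast; ring,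
      show (1 / 4 - x / 2 * I + (n + 1) : ℂ)
        = ((4 * (n : ℝ) + 5) / 4 : ℝ) - ((x / 2 : ℝ) : ℂ) * I by push_cast; ring]
    rw [div_neg, div_neg]
    ring
  · have k0 := scale 1 one_ne_zero
    rw [← key _ _ (by norm_num)] at k0
    have hcot := cot_pi_mul_add_cot_pi_mul x
    push_cast at k0 hcot ⊢
    rw [one_pow] at k0
    linear_combination (-(Real.pi : ℂ) / 8) * hcot + k0

/-- An absolutely convergent form of the partial fraction expansion of the hyperbolic secant. -/
lemma hasSum_neg_one_pow_div_odd_mul (x : ℝ) (hx : x ≠ 0) :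
    HasSum (fun n : ℕ ↦ (-1 : ℝ) ^ n /
        ((2 * (n : ℝ) + 1) * ((2 * (n : ℝ) + 1) ^ 2 + 4 * x ^ 2)))
      (Real.pi / 16 * (1 - 1 / Real.cosh (Real.pi * x)) / x ^ 2) := by
  set f : ℕ → ℝ := fun n ↦ (-1 : ℝ) ^ n /
        ((2 * (n : ℝ) + 1) * ((2 * (n : ℝ) + 1) ^ 2 + 4 * x ^ 2)) with hf
  have hs : Summable f := by
    refine Summable.of_norm_bounded hasSum_one_div_succ_sq.summable fun n ↦ ?_
    have hn : (0 : ℝ) ≤ n := n.cast_nonneg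
    rw [hf, norm_div, norm_pow, norm_neg, norm_one, one_pow, Real.norm_of_nonneg (by positivity)]
    apply one_div_le_one_div_of_le (by positivity)
    nlinarith [mul_nonneg hn hn, mul_nonneg hn (mul_nonneg hn hn), mul_nonneg hn (sq_nonneg x),
      sq_nonneg x]
  have h1 := (hs.comp_injective (i := fun n ↦ 2 * n + 1) fun a b h ↦ by grind).hasSum
  have h2 := (hs.comp_injective (i := fun n ↦ 2 * n + 2) fun a b h ↦ by grind).hasSum
  have h3 : HasSum (fun n ↦ f (n + 1)) _ := HasSum.even_add_odd h1 h2
  have h4 := (hasSum_nat_add_iff 1).1 h3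
  have h5 := ((hasSum_sech_paired 0).sub (hasSum_sech_paired x)).mul_left (1 / (4 * x ^ 2))
  have h6 := (h1.add h2).unique (a₂ := _) (by
    convert! h5 using 1
    ext n
    have e1 : (-1 : ℝ) ^ (2 * n + 1) = -1 := by simp [pow_succ, pow_mul]
    have e2 : (-1 : ℝ) ^ (2 * n + 2) = 1 := by simp [pow_succ, pow_mul]
    have p1 : (4 * (n : ℝ) + 5) ^ 2 + 4 * x ^ 2 ≠ 0 := by positivity
    have p2 : (4 * (n : ℝ) + 3) ^ 2 + 4 * x ^ 2 ≠ 0 := by positivity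
    have p3 : 4 * (n : ℝ) + 5 ≠ 0 := by positivity
    have p4 : 4 * (n : ℝ) + 3 ≠ 0 := by positivity
    simp only [Function.comp, hf, e1, e2]
    push_cast
    rw [show 2 * (2 * (n : ℝ) + 1) + 1 = 4 * n + 3 by ring,
      show 2 * (2 * (n : ℝ) + 2) + 1 = 4 * n + 5 by ring]
    field_simp
    ring)
  rw [h6] at h4
  convert! h4 using 1
  have p : 1 + 4 * x ^ 2 ≠ 0 := by positivity
  have hc := (Real.cosh_pos (Real.pi * x)).ne'
  simp [hf]
  field_simp
  ring

/-- The value at `3` of the Dirichlet beta function. -/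
lemma hasSum_neg_one_pow_div_odd_cube :
    HasSum (fun n : ℕ ↦ (-1 : ℝ) ^ n / (2 * (n : ℝ) + 1) ^ 3) (Real.pi ^ 3 / 32) := by
  have h := hasSum_L_function_mod_four_eval_three
  have hi : Function.Injective (fun n : ℕ ↦ 2 * n + 1) := fun a b h ↦ by grind
  rw [← hi.hasSum_iff] at h
  · convert! h using 1
    ext n
    have : Real.sin (Real.pi * ((2 * n + 1 : ℕ) : ℝ) / 2) = (-1) ^ n := by
      rw [show Real.pi * ((2 * n + 1 : ℕ) : ℝ) / 2 = Real.pi / 2 + n * Real.pi by push_cast; ring,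
        Real.sin_add_nat_mul_pi, Real.sin_pi_div_two, mul_one]
    simp only [Function.comp, this]
    push_cast
    ring
  · intro m hm
    obtain ⟨k, rfl⟩ : Even m := by
      by_contra hodd
      obtain ⟨k, hk⟩ := Nat.not_even_iff_odd.1 hodd
      exact hm ⟨k, hk.symm⟩
    rw [show Real.pi * ((k + k : ℕ) : ℝ) / 2 = k * Real.pi by push_cast; ring, Real.sin_nat_mul_pi,
      mul_zero]


/-- Ramanujan's formula for Catalan's constant:
`G = 5π²/48 − 2 ∑_{n≥0} (−1)^n (2n+1)^{−2}/(e^{(2n+1)π} − 1)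
     − (1/4) ∑_{n≥1} 1/(n² cosh(πn))`. -/
theorem ramanujan_catalan :
    ∑' n : ℕ, (-1 : ℝ) ^ n / (2 * (n : ℝ) + 1) ^ 2
    = 5 * Real.pi ^ 2 / 48
      - 2 * ∑' n : ℕ, (-1 : ℝ) ^ n * ((2 * (n : ℝ) + 1) ^ 2)⁻¹
          / (Real.exp ((2 * (n : ℝ) + 1) * Real.pi) - 1)
      - (1 / 4) * ∑' n : ℕ, ((((n : ℝ) + 1) ^ 2) * Real.cosh (Real.pi * ((n : ℝ) + 1)))⁻¹ := by
  have hE (n : ℕ) : 1 ≤ Real.exp ((2 * (n : ℝ) + 1) * Real.pi) - 1 := by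
    have h1 := Real.add_one_le_exp ((2 * (n : ℝ) + 1) * Real.pi)
    nlinarith [Real.pi_gt_three, n.cast_nonneg (α := ℝ)]
  have hsq := hasSum_one_div_succ_sq.summable
  have hodd : Summable fun n : ℕ ↦ 1 / (2 * (n : ℝ) + 1) ^ 2 := by
    refine Summable.of_nonneg_of_le (fun n ↦ by positivity) (fun n ↦ ?_) hsq
    gcongr
    linarith [n.cast_nonneg (α := ℝ)]
  have habs (n : ℕ) : |(-1 : ℝ) ^ n| = 1 := by simp
  have hS0 : Summable fun n : ℕ ↦ (-1 : ℝ) ^ n / (2 * (n : ℝ) + 1) ^ 2 := by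
    refine Summable.of_norm_bounded hodd fun n ↦ le_of_eq ?_
    rw [Real.norm_eq_abs, abs_div, habs, abs_of_nonneg (by positivity)]
  have hS1 : Summable fun n : ℕ ↦ (-1 : ℝ) ^ n * ((2 * (n : ℝ) + 1) ^ 2)⁻¹
      / (Real.exp ((2 * (n : ℝ) + 1) * Real.pi) - 1) := by
    refine Summable.of_norm_bounded hodd fun n ↦ ?_
    rw [Real.norm_eq_abs, abs_div, abs_mul, habs, one_mul, abs_of_nonneg (by positivity),
      abs_of_nonneg (zero_le_one.trans (hE n)), one_div]
    exact div_le_self (by positivity) (hE n)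
  have hS2 : Summable fun n : ℕ ↦
      ((((n : ℝ) + 1) ^ 2) * Real.cosh (Real.pi * ((n : ℝ) + 1)))⁻¹ := by
    refine Summable.of_nonneg_of_le (fun n ↦ ?_) (fun n ↦ ?_) hsq
    · have := Real.cosh_pos (Real.pi * ((n : ℝ) + 1))
      positivity
    · rw [← one_div]
      have := Real.one_le_cosh (Real.pi * ((n : ℝ) + 1))
      gcongr
      exact le_mul_of_one_le_right (by positivity) this
  set T : ℕ → ℕ → ℝ := fun n k ↦ (-1 : ℝ) ^ n /
    ((2 * (n : ℝ) + 1) * ((2 * (n : ℝ) + 1) ^ 2 + 4 * ((k : ℝ) + 1) ^ 2)) with hT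
  have hrow (n : ℕ) : HasSum (fun k : ℕ ↦ 1 /
      ((2 * (n : ℝ) + 1) * ((2 * (n : ℝ) + 1) ^ 2 + 4 * ((k : ℝ) + 1) ^ 2)))
      (Real.pi / 4 * (1 / (2 * (n : ℝ) + 1) ^ 2)
        + Real.pi / 2 * (((2 * (n : ℝ) + 1) ^ 2)⁻¹
          / (Real.exp ((2 * (n : ℝ) + 1) * Real.pi) - 1))
        - 1 / 2 * (1 / (2 * (n : ℝ) + 1) ^ 3)) := by
    have h := (hasSum_one_div_sq_add_sq (y := (2 * (n : ℝ) + 1) / 2) (by positivity)).mul_left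
      (1 / (4 * (2 * (n : ℝ) + 1)))
    rw [show 2 * Real.pi * ((2 * (n : ℝ) + 1) / 2) = (2 * (n : ℝ) + 1) * Real.pi by ring] at h
    have hm : 2 * (n : ℝ) + 1 ≠ 0 := by positivity
    convert! h using 1
    · ext k
      rw [div_mul_div_comm, one_mul]
      congr 1
      ring
    · have := (zero_lt_one.trans_le (hE n)).ne'
      field_simp
      ring
  have hrowT (n : ℕ) : HasSum (T n)
      (Real.pi / 4 * ((-1 : ℝ) ^ n / (2 * (n : ℝ) + 1) ^ 2)
        + Real.pi / 2 * ((-1 : ℝ) ^ n * ((2 * (n : ℝ) + 1) ^ 2)⁻¹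
          / (Real.exp ((2 * (n : ℝ) + 1) * Real.pi) - 1))
        - 1 / 2 * ((-1 : ℝ) ^ n / (2 * (n : ℝ) + 1) ^ 3)) := by
    convert! (hrow n).mul_left ((-1 : ℝ) ^ n) using 1
    · ext k
      simp only [hT]
      ring
    · ring
  have hTsum : Summable (Function.uncurry T) := by
    apply Summable.of_norm
    rw [summable_prod_of_nonneg fun p ↦ norm_nonneg _]
    have hnorm (n k : ℕ) : ‖Function.uncurry T (n, k)‖ = 1 /
        ((2 * (n : ℝ) + 1) * ((2 * (n : ℝ) + 1) ^ 2 + 4 * ((k : ℝ) + 1) ^ 2)) := by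
      simp only [Function.uncurry, hT]
      rw [Real.norm_eq_abs, abs_div, habs, abs_of_nonneg (by positivity)]
    simp only [hnorm]
    refine ⟨fun n ↦ (hrow n).summable, ?_⟩
    simp only [fun n ↦ (hrow n).tsum_eq]
    refine Summable.sub (Summable.add (hodd.mul_left _) (Summable.mul_left _ ?_))
      (Summable.mul_left _ ?_)
    · refine hS1.norm.congr fun n ↦ ?_
      rw [Real.norm_eq_abs, abs_div, abs_mul, habs, one_mul, abs_of_nonneg (by positivity),
        abs_of_nonneg (zero_le_one.trans (hE n))]
    · refine hasSum_neg_one_pow_div_odd_cube.summable.norm.congr fun n ↦ ?_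
      rw [Real.norm_eq_abs, abs_div, habs, abs_of_nonneg (by positivity)]
  have hcomm := hTsum.tsum_comm
  have hL := ((hS0.hasSum.mul_left (Real.pi / 4)).add (hS1.hasSum.mul_left (Real.pi / 2))).sub
    (hasSum_neg_one_pow_div_odd_cube.mul_left (1 / 2))
  have hR := (hasSum_one_div_succ_sq.sub hS2.hasSum).mul_left (Real.pi / 16)
  have hcol (k : ℕ) : ∑' n, T n k = Real.pi / 16 * (1 / ((k : ℝ) + 1) ^ 2 -
      ((((k : ℝ) + 1) ^ 2) * Real.cosh (Real.pi * ((k : ℝ) + 1)))⁻¹) := by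
    rw [(hasSum_neg_one_pow_div_odd_mul ((k : ℝ) + 1) (by positivity)).tsum_eq]
    have := (Real.cosh_pos (Real.pi * ((k : ℝ) + 1))).ne'
    field_simp
  simp only [fun n ↦ (hrowT n).tsum_eq, hcol] at hcomm
  rw [hL.tsum_eq, hR.tsum_eq] at hcomm
  apply mul_left_cancel₀ (div_ne_zero Real.pi_ne_zero (four_ne_zero' ℝ))
  linear_combination -hcomm
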